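/- Let (R, m) be a Noetherian local ring and I, J proper ideals such that √I ⊄ √J, √J ⊄ √I, and I ∩ J is a cohomologically complete intersection of height h (i.e., H^i_{I∩J}(R) = 0 for all i ≠ h). Then depth(I + J, R) ≤ h + 1. -/

import Mathlib

open scoped Classical

/-- The depth of the `R`-module `M` along the ideal `I`: the supremum of lengths of
`M`-regular sequences contained in `I`, with the convention that it is `⊤` if `IM = M`. -/
noncomputable def Ideal.depthENat {R : Type*} [CommRing R] (I : Ideal R)
    (M : Type*) [AddCommGroup M] [Module R M] : ℕ∞ :=
  if I • (⊤ : Submodule R M) = ⊤ then ⊤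
  else sSup {n : ℕ∞ | ∃ rs : List R, (∀ r ∈ rs, r ∈ I) ∧
      RingTheory.Sequence.IsRegular M rs ∧ (rs.length : ℕ∞) = n}

/-- The height of an ideal: the infimum of the heights of the primes minimal over it. -/
noncomputable def Ideal.heightENat {R : Type*} [CommRing R] (I : Ideal R) : ℕ∞ :=
  sInf {n : ℕ∞ | ∃ p : PrimeSpectrum R, p.asIdeal ∈ I.minimalPrimes ∧ Order.height p = n}

section Auxiliary

open CategoryTheory CategoryTheory.Limits CategoryTheory.Abelian

universe u v w

/-- The transition map `R ⧸ K ^ m ⟶ R ⧸ K ^ n` for `n ≤ m`. -/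
noncomputable def quotientPowMap {R : Type u} [CommRing R] (K : Ideal R) {n m : ℕ} (h : n ≤ m) :
    ModuleCat.of R (R ⧸ K ^ m) ⟶ ModuleCat.of R (R ⧸ K ^ n) :=
  ModuleCat.ofHom (Submodule.mapQ _ _ LinearMap.id (Ideal.pow_le_pow_right h))

/-- The direct system `Ext i (R ⧸ K ^ n) M` has vanishing colimit. -/
def ExtSystemVanishes {R : Type u} [CommRing R] (K : Ideal R) (M : ModuleCat.{u} R) (i : ℕ) :
    Prop :=
  ∀ (n : ℕ) (ξ : Abelian.Ext (ModuleCat.of R (R ⧸ K ^ n)) M i),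
    ∃ (m : ℕ) (h : n ≤ m), (Ext.mk₀ (quotientPowMap K h)).comp ξ (zero_add i) = 0

section DerivedComparison

variable {R : Type u} [CommRing R]

theorem exists_zero_of_subsingleton_localCohomology {K : Ideal R} {i : ℕ} {M : ModuleCat.{u} R}
    (hs : Subsingleton ((localCohomology K i).obj M)) (n : ℕ)
    (x : ((_root_.Ext R (ModuleCat.{u} R) i).obj
      (Opposite.op (ModuleCat.of R (R ⧸ K ^ n)))).obj M) :
    ∃ (m : ℕ) (h : n ≤ m),
      (((_root_.Ext R (ModuleCat.{u} R) i).map (quotientPowMap K h).op).app M) x = 0 := by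
  let F := localCohomology.diagram (localCohomology.idealPowersDiagram K) i
  have : HasColimit F := localCohomology.hasColimitDiagram _ i
  let c := ((evaluation (ModuleCat.{u} R) (ModuleCat.{u} R)).obj M).mapCocone (colimit.cocone F)
  have hc : IsColimit c := isColimitOfPreserves _ (colimit.isColimit F)
  have hs' : Subsingleton c.pt := hs
  have : IsFiltered (ℕᵒᵖ)ᵒᵖ := IsFiltered.of_equivalence (opOpEquivalence ℕ).symm
  have : PreservesFilteredColimitsOfSize.{0, 0} (forget (ModuleCat.{u} R)) :=
    preservesFilteredColimitsOfSize_shrink _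
  let j : (ℕᵒᵖ)ᵒᵖ := Opposite.op (Opposite.op n)
  obtain ⟨k, f, g, hfg⟩ := Concrete.isColimit_exists_of_rep_eq
    (F ⋙ (evaluation (ModuleCat.{u} R) (ModuleCat.{u} R)).obj M) hc (i := j) (j := j) x 0
    (Subsingleton.elim (α := c.pt) _ _)
  refine ⟨k.unop.unop, f.unop.unop.le, ?_⟩
  rw [map_zero] at hfg
  exact hfg

/-- An obstruction class in the derived-functor `Ext` that is killed by pulling back along `w`
detects that a cocycle becomes a coboundary. -/
theorem exists_cocycle_class {X M : ModuleCat.{u} R} (P : ProjectiveResolution X) (i : ℕ)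
    (f : P.complex.X i ⟶ M) (hf : P.complex.d (i + 1) i ≫ f = 0) :
    ∃ x : ((_root_.Ext R (ModuleCat.{u} R) i).obj (Opposite.op X)).obj M,
      ∀ {X' : ModuleCat.{u} R} (Q : ProjectiveResolution X') (w : X' ⟶ X) (φ : Q.Hom P w),
        ((_root_.Ext R (ModuleCat.{u} R) i).map w.op).app M x = 0 →
          ∃ g : Q.complex.X ((ComplexShape.down ℕ).next i) ⟶ M,
            φ.hom.f i ≫ f = Q.complex.d i _ ≫ g := by
  let F : ModuleCat.{u} R ⥤ (ModuleCat.{u} R)ᵒᵖ :=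
    ((linearYoneda R (ModuleCat.{u} R)).obj M).rightOp
  let A : (ModuleCat.{u} R)ᵒᵖ := Opposite.op (ModuleCat.of R R)
  let KP := (F.mapHomologicalComplex (ComplexShape.down ℕ)).obj P.complex
  let u : KP.X i ⟶ A := Quiver.Hom.op (ModuleCat.ofHom (LinearMap.toSpanSingleton R
    (P.complex.X i ⟶ M) f))
  have hprev : (ComplexShape.down ℕ).prev i = i + 1 := by simp
  have hu : KP.d (i + 1) i ≫ u = 0 := by
    apply Quiver.Hom.unop_inj
    ext
    change P.complex.d (i + 1) i ≫ ((1 : R) • f) = 0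
    rw [one_smul, hf]
  let α : KP.homology i ⟶ A := KP.homologyι i ≫ KP.descOpcycles u (i + 1) hprev hu
  let β : (F.leftDerived i).obj X ⟶ A := (P.isoLeftDerivedObj F i).hom ≫ α
  refine ⟨β.unop.hom (1 : R), ?_⟩
  intro X' Q w φ h0
  let KQ := (F.mapHomologicalComplex (ComplexShape.down ℕ)).obj Q.complex
  let Φ : KQ ⟶ KP := (F.mapHomologicalComplex (ComplexShape.down ℕ)).map φ.hom
  have h1 : (F.leftDerived i).map w ≫ β = 0 := by
    apply Quiver.Hom.unop_inj
    ext
    exact h0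
  have comm : φ.hom.f 0 ≫ P.π.f 0 = Q.π.f 0 ≫ w := by
    simpa using φ.hom_f_zero_comp_π_f_zero
  have h2 : HomologicalComplex.homologyMap Φ i ≫ α = 0 := by
    have := ProjectiveResolution.isoLeftDerivedObj_hom_naturality w Q P φ.hom comm F i
    have h : (Q.isoLeftDerivedObj F i).hom ≫ HomologicalComplex.homologyMap Φ i ≫ α = 0 := by
      rw [← h1]
      exact (Category.assoc _ _ _).symm.trans ((congrArg (· ≫ α) this.symm).trans
        (Category.assoc _ _ _))
    exact (cancel_epi (Q.isoLeftDerivedObj F i).hom).1 (h.trans comp_zero.symm)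
  have h3 : KQ.homologyι i ≫ KQ.descOpcycles (Φ.f i ≫ u) (i + 1) hprev
      (by rw [← Φ.comm_assoc, hu, comp_zero]) = 0 := by
    rw [← HomologicalComplex.opcyclesMap_comp_descOpcycles u (i + 1) hprev hu Φ,
      ← HomologicalComplex.homologyι_naturality_assoc]
    exact h2
  have hex : (ShortComplex.mk _ _ (KQ.homologyι_comp_fromOpcycles i
      ((ComplexShape.down ℕ).next i))).Exact :=
    ShortComplex.exact_of_f_is_kernel _ (KQ.homologyIsKernel i _ rfl)
  have : Projective (ModuleCat.of R R) := inferInstance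
  have : Injective A := inferInstance
  let v : KQ.X ((ComplexShape.down ℕ).next i) ⟶ A := hex.descToInjective _ h3
  have hv : KQ.fromOpcycles i _ ≫ v = _ := hex.comp_descToInjective _ h3
  have h4 : Φ.f i ≫ u = KQ.d i _ ≫ v := by
    rw [← KQ.p_fromOpcycles_assoc, hv, HomologicalComplex.p_descOpcycles]
  refine ⟨v.unop.hom (1 : R), ?_⟩
  have h5 := congrArg (fun t => t.unop.hom (1 : R)) h4
  change φ.hom.f i ≫ ((1 : R) • f) = Q.complex.d i _ ≫ v.unop.hom (1 : R) at h5
  rwa [one_smul] at h5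

theorem ExtSystemVanishes.of_subsingleton_localCohomology {K : Ideal R} {i : ℕ}
    {M : ModuleCat.{u} R} (hs : Subsingleton ((localCohomology K i).obj M)) :
    ExtSystemVanishes K M i := by
  intro n ξ
  let P := projectiveResolution (ModuleCat.of R (R ⧸ K ^ n))
  obtain ⟨f, hf, rfl⟩ := P.extMk_surjective ξ (i + 1) rfl
  obtain ⟨x, hx⟩ := exists_cocycle_class P i f hf
  obtain ⟨m, h, hm⟩ := exists_zero_of_subsingleton_localCohomology hs n x
  refine ⟨m, h, ?_⟩
  let Q := projectiveResolution (ModuleCat.of R (R ⧸ K ^ m))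
  let φ : Q.Hom P (quotientPowMap K h) :=
    { hom := ProjectiveResolution.lift (quotientPowMap K h) Q P
      hom_f_zero_comp_π_f_zero := ProjectiveResolution.lift_commutes_zero _ _ _ }
  have hg := hx Q _ φ hm
  rw [ProjectiveResolution.mk₀_comp_extMk f (i + 1) rfl hf φ]
  cases i with
  | zero =>
    obtain ⟨g, hg⟩ := hg
    have h0 : φ.hom.f 0 ≫ f = 0 := by
      rw [hg, HomologicalComplex.shape _ _ _ (by simp), zero_comp]
    simp [h0]
  | succ p =>
    rw [ProjectiveResolution.extMk_eq_zero_iff _ _ _ _ _ p rfl]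
    have hnext : (ComplexShape.down ℕ).next (p + 1) = p := by simp
    rw [hnext] at hg
    obtain ⟨g, hg⟩ := hg
    exact ⟨g, hg.symm⟩

end DerivedComparison

section ExtSystem

variable {R : Type u} [CommRing R]

/-- The short complex of modules attached to an exact pair of linear maps. -/
abbrev Function.Exact.moduleCatShortComplex {A B C : Type u} [AddCommGroup A] [Module R A]
    [AddCommGroup B] [Module R B] [AddCommGroup C] [Module R C] {f : A →ₗ[R] B} {g : B →ₗ[R] C}
    (h : Function.Exact f g) : ShortComplex (ModuleCat.{u} R) :=
  ShortComplex.mk (ModuleCat.ofHom f) (ModuleCat.ofHom g)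
    (by rw [← ModuleCat.ofHom_comp, h.linearMap_comp_eq_zero]; rfl)

theorem Function.Exact.moduleCatShortComplex_shortExact {A B C : Type u} [AddCommGroup A]
    [Module R A] [AddCommGroup B] [Module R B] [AddCommGroup C] [Module R C] {f : A →ₗ[R] B}
    {g : B →ₗ[R] C} (h : Function.Exact f g) (hf : Function.Injective f)
    (hg : Function.Surjective g) : h.moduleCatShortComplex.ShortExact where
  exact := by
    rw [ShortComplex.ShortExact.moduleCat_exact_iff_function_exact]
    exact h
  mono_f := (ModuleCat.mono_iff_injective _).2 hf
  epi_g := (ModuleCat.epi_iff_surjective _).2 hg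

theorem quotientPowMap_comp (K : Ideal R) {n m l : ℕ} (h : n ≤ m) (h' : m ≤ l) :
    quotientPowMap K h' ≫ quotientPowMap K h = quotientPowMap K (h.trans h') := by
  refine ModuleCat.hom_ext (LinearMap.ext fun x => ?_)
  obtain ⟨x, rfl⟩ := Submodule.mkQ_surjective _ x
  rfl

/-- Every element of `M` is killed by a power of `K`. -/
def IsPowTorsion (K : Ideal R) (M : Type*) [AddCommGroup M] [Module R M] : Prop :=
  ∀ z : M, ∃ m : ℕ, ∀ r ∈ K ^ m, r • z = 0

theorem ExtSystemVanishes.of_shortExact₃ {K : Ideal R} {S : ShortComplex (ModuleCat.{u} R)}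
    (hS : S.ShortExact) {i : ℕ} (h₂ : ExtSystemVanishes K S.X₂ i)
    (h₁ : ExtSystemVanishes K S.X₁ (i + 1)) : ExtSystemVanishes K S.X₃ i := by
  intro n ξ
  obtain ⟨m, hm, h⟩ := h₁ n (ξ.comp hS.extClass rfl)
  rw [← Ext.comp_assoc (a₁₂ := i) (h₁₂ := zero_add i) (h := by omega)] at h
  obtain ⟨ζ, hζ⟩ := Ext.covariant_sequence_exact₃ _ hS _ rfl h
  obtain ⟨l, hl, h'⟩ := h₂ m ζ
  refine ⟨l, hm.trans hl, ?_⟩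
  rw [← quotientPowMap_comp K hm hl, ← Ext.mk₀_comp_mk₀_assoc, ← hζ,
    ← Ext.comp_assoc_of_third_deg_zero, h', Ext.zero_comp]

theorem comp_extClass_eq_zero_of_factor {S' S : ShortComplex (ModuleCat.{u} R)}
    (hS' : S'.ShortExact) (hS : S.ShortExact) (Φ : S' ⟶ S) {Z M : ModuleCat.{u} R}
    {b : S'.X₁ ⟶ Z} {j : Z ⟶ S.X₁} (hfac : Φ.τ₁ = b ≫ j) {i k : ℕ} {η : Ext S.X₁ M i}
    (hη : (Ext.mk₀ j).comp η (zero_add i) = 0) (hk : 1 + i = k) :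
    (Ext.mk₀ Φ.τ₃).comp (hS.extClass.comp η hk) (zero_add k) = 0 := by
  rw [← Ext.comp_assoc (a₁₂ := 1) (h₁₂ := zero_add 1) (h := by omega),
    ← ShortComplex.ShortExact.extClass_naturality hS' hS Φ,
    Ext.comp_assoc (a₂₃ := i) (h₂₃ := zero_add i) (h := by omega), hfac,
    ← Ext.mk₀_comp_mk₀_assoc, hη, Ext.comp_zero, Ext.comp_zero]

/-- The inclusion of `K ^ m • N` into `N`. -/
def powSMulInclusion (K : Ideal R) (m : ℕ) (N : Type u) [AddCommGroup N] [Module R N] :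
    ModuleCat.of R (K ^ m • (⊤ : Submodule R N) : Submodule R N) ⟶ ModuleCat.of R N :=
  ModuleCat.ofHom (Submodule.subtype _)

theorem IsPowTorsion.exists_forall_of_fg {K : Ideal R} {M : Type*} [AddCommGroup M] [Module R M]
    (hM : IsPowTorsion K M) {P : Submodule R M} (hP : P.FG) :
    ∃ m : ℕ, ∀ r ∈ K ^ m, ∀ z ∈ P, r • z = 0 := by
  obtain ⟨s, rfl⟩ := hP
  choose m hm using hM
  refine ⟨s.sup m, fun r hr z hz => ?_⟩
  induction hz using Submodule.span_induction with
  | mem x hx => exact hm x r (Ideal.pow_le_pow_right (Finset.le_sup hx) hr)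
  | zero => simp
  | add x y _ _ hx hy => rw [smul_add, hx, hy, add_zero]
  | smul a x _ hx => rw [smul_comm, hx, smul_zero]

theorem IsPowTorsion.exists_restrict_eq_zero [IsNoetherianRing R] {K : Ideal R}
    {M : ModuleCat.{u} R} (hM : IsPowTorsion K M) (i : ℕ) (N : Type u) [AddCommGroup N]
    [Module R N] [Module.Finite R N] (ξ : Ext (ModuleCat.of R N) M i) :
    ∃ m, (Ext.mk₀ (powSMulInclusion K m N)).comp ξ (zero_add i) = 0 := by
  induction i generalizing N with
  | zero =>
    obtain ⟨f, rfl⟩ := Ext.mk₀_bijective _ _ |>.2 ξ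
    obtain ⟨m, hm⟩ := hM.exists_forall_of_fg (P := LinearMap.range f.hom)
      (by rw [LinearMap.range_eq_map]; exact Module.Finite.fg_top.map _)
    refine ⟨m, ?_⟩
    have : powSMulInclusion K m N ≫ f = 0 := by
      ext ⟨z, hz⟩
      change f.hom z = 0
      induction hz using Submodule.smul_induction_on' with
      | smul r hr x hx => rw [map_smul]; exact hm r hr _ ⟨x, rfl⟩
      | add x hx y hy h1 h2 => rw [map_add, h1, h2, add_zero]
    rw [Ext.mk₀_comp_mk₀, this, Ext.mk₀_zero]
  | succ i ih =>
    obtain ⟨n, p, hp⟩ := Module.Finite.exists_fin' R N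
    have hex : Function.Exact (LinearMap.ker p).subtype p := by
      rw [LinearMap.exact_iff, Submodule.range_subtype]
    have hS := hex.moduleCatShortComplex_shortExact (Submodule.subtype_injective _) hp
    have : Projective hex.moduleCatShortComplex.X₂ :=
      inferInstanceAs (Projective (ModuleCat.of R (Fin n → R)))
    obtain ⟨η, hη⟩ := Ext.contravariant_sequence_exact₃ hS M ξ
      (Ext.eq_zero_of_projective _) (add_comm 1 i)
    obtain ⟨c, hc⟩ := ih (LinearMap.ker p) η
    obtain ⟨k, hk⟩ := Ideal.exists_pow_inf_eq_pow_smul K (LinearMap.ker p)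
    have hAR : K ^ (k + c) • (⊤ : Submodule R (Fin n → R)) ⊓ LinearMap.ker p ≤
        (K ^ c • (⊤ : Submodule R (LinearMap.ker p))).map (LinearMap.ker p).subtype := by
      rw [hk _ (Nat.le_add_right k c), Nat.add_sub_cancel_left, Submodule.map_smul'',
        Submodule.map_top, Submodule.range_subtype]
      exact Submodule.smul_mono le_rfl inf_le_right
    refine ⟨k + c, ?_⟩
    have hmap : (K ^ (k + c) • (⊤ : Submodule R (Fin n → R))).map p = K ^ (k + c) • ⊤ := by
      rw [Submodule.map_smul'', Submodule.map_top, LinearMap.range_eq_top.2 hp]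
    let q : (K ^ (k + c) • (⊤ : Submodule R (Fin n → R)) : Submodule R (Fin n → R)) →ₗ[R]
        (K ^ (k + c) • (⊤ : Submodule R N) : Submodule R N) :=
      p.restrict fun x hx => hmap ▸ Submodule.mem_map_of_mem hx
    have hq : Function.Surjective q := by
      rintro ⟨y, hy⟩
      obtain ⟨x, hx, rfl⟩ := hmap.symm ▸ hy
      exact ⟨⟨x, hx⟩, rfl⟩
    have hex' : Function.Exact (LinearMap.ker q).subtype q := by
      rw [LinearMap.exact_iff, Submodule.range_subtype]
    have hS' := hex'.moduleCatShortComplex_shortExact (Submodule.subtype_injective _) hq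
    have hmem : ∀ x : LinearMap.ker q, (x : Fin n → R) ∈ LinearMap.ker p := by
      rintro ⟨x, hx⟩
      exact congrArg Subtype.val hx
    let a : LinearMap.ker q →ₗ[R] LinearMap.ker p :=
      LinearMap.codRestrict _ (Submodule.subtype _ ∘ₗ Submodule.subtype _) hmem
    have ha : ∀ x, a x ∈ K ^ c • (⊤ : Submodule R (LinearMap.ker p)) := by
      intro x
      obtain ⟨y, hy, hyx⟩ := hAR ⟨x.1.2, hmem x⟩
      rwa [show a x = y from Subtype.ext hyx.symm]
    let b : LinearMap.ker q →ₗ[R] (K ^ c • (⊤ : Submodule R (LinearMap.ker p)) :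
      Submodule R (LinearMap.ker p)) := LinearMap.codRestrict _ a ha
    rw [← hη]
    exact comp_extClass_eq_zero_of_factor hS' hS
      { τ₁ := ModuleCat.ofHom a
        τ₂ := ModuleCat.ofHom (K ^ (k + c) • (⊤ : Submodule R (Fin n → R))).subtype
        τ₃ := powSMulInclusion K (k + c) N
        comm₁₂ := rfl
        comm₂₃ := rfl } (b := ModuleCat.ofHom b)
      (j := powSMulInclusion K c (LinearMap.ker p)) rfl hc _

theorem IsPowTorsion.extSystemVanishes_succ [IsNoetherianRing R] {K : Ideal R}
    {M : ModuleCat.{u} R} (hM : IsPowTorsion K M) (i : ℕ) : ExtSystemVanishes K M (i + 1) := by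
  intro n ξ
  have hex (m : ℕ) : Function.Exact (K ^ m).subtype (K ^ m).mkQ := by
    rw [LinearMap.exact_iff, Submodule.range_subtype, Submodule.ker_mkQ]
  have hS (m : ℕ) := (hex m).moduleCatShortComplex_shortExact (Submodule.subtype_injective _)
    (Submodule.mkQ_surjective _)
  have : Projective (hex n).moduleCatShortComplex.X₂ :=
      inferInstanceAs (Projective (ModuleCat.of R R))
  obtain ⟨η, hη⟩ := Ext.contravariant_sequence_exact₃ (hS n) M ξ
      (Ext.eq_zero_of_projective _) (add_comm 1 i)
  obtain ⟨c, hc⟩ := hM.exists_restrict_eq_zero i (K ^ n : Ideal R) η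
  refine ⟨c + n, Nat.le_add_left n c, ?_⟩
  have hle : K ^ (c + n) ≤ K ^ n := Ideal.pow_le_pow_right (Nat.le_add_left n c)
  have hb : ∀ x : (K ^ (c + n) : Ideal R), Submodule.inclusion hle x ∈
      K ^ c • (⊤ : Submodule R (K ^ n : Ideal R)) := by
    rintro ⟨x, hx⟩
    have : K ^ (c + n) = (K ^ c • (⊤ : Submodule R (K ^ n : Ideal R))).map
        (K ^ n).subtype := by
      rw [Submodule.map_smul'', Submodule.map_top, Submodule.range_subtype, pow_add, smul_eq_mul]
    obtain ⟨y, hy, hyx⟩ := this ▸ hx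
    rwa [show Submodule.inclusion hle ⟨x, hx⟩ = y from Subtype.ext hyx.symm]
  let b : (K ^ (c + n) : Ideal R) →ₗ[R] (K ^ c • (⊤ : Submodule R (K ^ n : Ideal R)) :
      Submodule R (K ^ n : Ideal R)) := LinearMap.codRestrict _ (Submodule.inclusion hle) hb
  let Φ : (hex (c + n)).moduleCatShortComplex ⟶ (hex n).moduleCatShortComplex :=
    { τ₁ := ModuleCat.ofHom (Submodule.inclusion hle)
      τ₂ := 𝟙 _
      τ₃ := quotientPowMap K (Nat.le_add_left n c)
      comm₁₂ := rfl
      comm₂₃ := rfl }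
  rw [← hη]
  exact comp_extClass_eq_zero_of_factor (hS (c + n)) (hS n) Φ (b := ModuleCat.ofHom b)
    (j := powSMulInclusion K c (K ^ n : Ideal R)) rfl hc _

theorem ExtSystemVanishes.eq_zero_of_pow_smul {K : Ideal R} {M : ModuleCat.{u} R}
    (hM : ExtSystemVanishes K M 0) {n : ℕ} {z : M} (hz : ∀ r ∈ K ^ n, r • z = 0) : z = 0 := by
  let f : (R ⧸ K ^ n) →ₗ[R] M := (K ^ n).liftQ (LinearMap.toSpanSingleton R M z)
    fun r hr => hz r hr
  obtain ⟨m, h, hm⟩ := hM n (Ext.mk₀ (ModuleCat.ofHom f))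
  rw [Ext.mk₀_comp_mk₀] at hm
  have h0 : quotientPowMap K h ≫ ModuleCat.ofHom f = 0 :=
    (Ext.mk₀_bijective _ _).1 (hm.trans (Ext.mk₀_zero _ _).symm)
  have h1 := congrArg (fun g => g.hom (Submodule.Quotient.mk (1 : R))) h0
  change (1 : R) • z = 0 at h1
  rwa [one_smul] at h1

theorem extSystemVanishes_zero {K : Ideal R} {M : ModuleCat.{u} R}
    (hM : ∀ (n : ℕ) (z : M), (∀ r ∈ K ^ n, r • z = 0) → z = 0) : ExtSystemVanishes K M 0 := by
  intro n ξ
  obtain ⟨f, rfl⟩ := Ext.mk₀_bijective _ _ |>.2 ξ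
  have : f = 0 := by
    refine ModuleCat.hom_ext (LinearMap.ext fun x => ?_)
    obtain ⟨x, rfl⟩ := Submodule.mkQ_surjective _ x
    apply hM n
    intro r hr
    rw [← map_smul, ← map_smul]
    have : (K ^ n).mkQ (r • x) = 0 := by
      rw [Submodule.mkQ_apply, Submodule.Quotient.mk_eq_zero]
      exact Ideal.mul_mem_right _ _ hr
    change f.hom ((K ^ n).mkQ (r • x)) = 0
    rw [this, map_zero]
  exact ⟨n, le_rfl, by rw [this, Ext.mk₀_zero, Ext.comp_zero]⟩

end ExtSystem

section Triangulated

open Pretriangulated Opposite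

variable {C : Type u} [Category.{v} C] [Preadditive C] [HasZeroObject C] [HasShift C ℤ]
  [∀ n : ℤ, (shiftFunctor C n).Additive] [Pretriangulated C]

/-- The connecting morphism of a triangle, as a morphism of degree `1`. -/
abbrev shiftedMor₃ (T : Triangle C) :
    ShiftedHom T.obj₃ T.obj₁ (1 : ℤ) := T.mor₃

theorem exists_comp_mor₁_of_distTriang {T : Triangle C} (hT : T ∈ distTriang C) {Y : C} {n : ℤ}
    (f : ShiftedHom Y T.obj₂ n) (hf : f ≫ T.mor₂⟦n⟧' = 0) :
    ∃ g : ShiftedHom Y T.obj₁ n, g ≫ T.mor₁⟦n⟧' = f := by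
  have := (preadditiveCoyoneda.obj (op Y)).homologySequence_exact₂ _ hT n
  rw [ShortComplex.ab_exact_iff] at this
  exact this f hf

theorem exists_comp_mor₂_of_distTriang {T : Triangle C} (hT : T ∈ distTriang C) {Y : C} {n n' : ℤ}
    (h : 1 + n = n') (f : ShiftedHom Y T.obj₃ n)
    (hf : f.comp (shiftedMor₃ T) h = 0) :
    ∃ g : ShiftedHom Y T.obj₂ n, g ≫ T.mor₂⟦n⟧' = f := by
  have := (preadditiveCoyoneda.obj (op Y)).homologySequence_exact₃ _ hT n n' (by lia)
  rw [ShortComplex.ab_exact_iff] at this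
  refine this f ?_
  refine (Pretriangulated.preadditiveCoyoneda_homologySequenceδ_apply T n n' (by lia) _).trans ?_
  exact hf

theorem exists_comp_mor₃_of_distTriang {T : Triangle C} (hT : T ∈ distTriang C) {Y : C} {n n' : ℤ}
    (h : 1 + n = n') (f : ShiftedHom Y T.obj₁ n') (hf : f ≫ T.mor₁⟦n'⟧' = 0) :
    ∃ g : ShiftedHom Y T.obj₃ n,
      g.comp (shiftedMor₃ T) h = f := by
  have := (preadditiveCoyoneda.obj (op Y)).homologySequence_exact₁ _ hT n n' (by lia)
  rw [ShortComplex.ab_exact_iff] at this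
  obtain ⟨g, hg⟩ := this f hf
  refine ⟨g, Eq.trans ?_ hg⟩
  exact (preadditiveCoyoneda_homologySequenceδ_apply T n n' (by lia) _).symm

theorem exists_mor₃_comp_of_distTriang {T : Triangle C} (hT : T ∈ distTriang C) {X : C} {n n' : ℤ}
    (h : n + 1 = n') (f : ShiftedHom T.obj₃ X n') (hf : T.mor₂ ≫ f = 0) :
    ∃ g : ShiftedHom T.obj₁ X n,
      (shiftedMor₃ T).comp g h = f := by
  obtain ⟨g, hg⟩ := Triangle.yoneda_exact₃ T hT f hf
  obtain ⟨e, he⟩ := (shiftFunctor C (1 : ℤ)).map_surjective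
    (g ≫ (shiftFunctorAdd' C n 1 n' h).hom.app X)
  refine ⟨e, ?_⟩
  rw [ShiftedHom.comp, he, hg]
  simp

theorem exists_mor₁_comp_of_distTriang {T : Triangle C} (hT : T ∈ distTriang C) {X : C} {n n' : ℤ}
    (h : n + 1 = n') (g : ShiftedHom T.obj₁ X n)
    (hg : (shiftedMor₃ T).comp g h = 0) :
    ∃ e : ShiftedHom T.obj₂ X n, T.mor₁ ≫ e = g := by
  have h₁ : T.mor₃ ≫ g⟦(1 : ℤ)⟧' = 0 := by
    rw [ShiftedHom.comp, ← Category.assoc] at hg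
    exact (cancel_mono ((shiftFunctorAdd' C n 1 n' h).inv.app X)).1 (by simpa using hg)
  obtain ⟨e, he⟩ : ∃ e : (shiftFunctor C (1 : ℤ)).obj T.obj₂ ⟶ _,
      g⟦(1 : ℤ)⟧' = (-T.mor₁⟦(1 : ℤ)⟧') ≫ e :=
    Triangle.yoneda_exact₃ _ (rot_of_distTriang T hT) (g⟦(1 : ℤ)⟧') h₁
  obtain ⟨e', he'⟩ := (shiftFunctor C (1 : ℤ)).map_surjective e
  refine ⟨-e', (shiftFunctor C (1 : ℤ)).map_injective ?_⟩
  rw [he, ← he']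
  rw [Preadditive.comp_neg, Functor.map_neg, Preadditive.neg_comp, Functor.map_comp]

theorem mor₁_comp_mor₃_of_distTriang {T : Triangle C} (hT : T ∈ distTriang C) {X : C} {n n' : ℤ}
    (h : n + 1 = n') (e : ShiftedHom T.obj₂ X n) :
    (shiftedMor₃ T).comp (T.mor₁ ≫ e : ShiftedHom T.obj₁ X n) h
      = 0 := by
  rw [ShiftedHom.comp, Functor.map_comp, Category.assoc, ← Category.assoc,
    comp_distTriang_mor_zero₃₁ T hT, zero_comp]

end Triangulated

theorem ModuleCat.isIso_smul_id {R : Type u} [CommRing R] {M : ModuleCat.{v} R} {x : R}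
    (hx : Function.Bijective fun m : M => x • m) : IsIso (x • 𝟙 M) := by
  rw [ConcreteCategory.isIso_iff_bijective]
  exact hx

section HyperExt

variable {R : Type u} [CommRing R] [HasDerivedCategory.{w} (ModuleCat.{u} R)]

/-- Hyper-Ext groups from an object of the derived category to a module. -/
abbrev HyperExt (Y : DerivedCategory (ModuleCat.{u} R)) (M : ModuleCat.{u} R) (i : ℤ) : Type w :=
  ShiftedHom Y ((DerivedCategory.singleFunctor (ModuleCat.{u} R) 0).obj M) i

variable {Y : DerivedCategory (ModuleCat.{u} R)} {M N L : ModuleCat.{u} R} {i : ℤ}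

/-- Functoriality of hyper-Ext groups in the module. -/
noncomputable def HyperExt.map (φ : M ⟶ N) (f : HyperExt Y M i) : HyperExt Y N i :=
  f ≫ ((DerivedCategory.singleFunctor (ModuleCat.{u} R) 0).map φ)⟦i⟧'

namespace HyperExt

theorem map_id (f : HyperExt Y M i) : map (𝟙 M) f = f := by simp [map]

theorem map_comp (φ : M ⟶ N) (ψ : N ⟶ L) (f : HyperExt Y M i) :
    map (φ ≫ ψ) f = map ψ (map φ f) := by simp [map]

theorem map_zero_hom (f : HyperExt Y M i) : map (0 : M ⟶ N) f = 0 := by simp [map]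

theorem map_zero (φ : M ⟶ N) : map φ (0 : HyperExt Y M i) = 0 := by simp [map]

theorem map_sub (φ : M ⟶ N) (f g : HyperExt Y M i) : map φ (f - g) = map φ f - map φ g := by
  simp [map]

theorem map_add_hom (φ ψ : M ⟶ N) (f : HyperExt Y M i) : map (φ + ψ) f = map φ f + map ψ f := by
  simp [map]

theorem map_sum_hom {ι : Type*} (t : Finset ι) (φ : ι → (M ⟶ N)) (f : HyperExt Y M i) :
    map (∑ j ∈ t, φ j) f = ∑ j ∈ t, map (φ j) f := by
  induction t using Finset.induction_on with
  | empty => simp [map_zero_hom]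
  | insert a t ha ih => rw [Finset.sum_insert ha, Finset.sum_insert ha, map_add_hom, ih]

theorem map_smul_hom (r : R) (φ : M ⟶ N) (f : HyperExt Y M i) : map (r • φ) f = r • map φ f := by
  simp [map, Functor.map_smul]

theorem map_smul (r : R) (φ : M ⟶ N) (f : HyperExt Y M i) : map φ (r • f) = r • map φ f := by
  simp [map]

theorem map_smul_id (r : R) (f : HyperExt Y M i) : map (r • 𝟙 M) f = r • f := by
  rw [map_smul_hom, map_id]

theorem eq_zero_of_smul_eq_zero {x : R} (hx : Function.Bijective fun m : M => x • m)
    {f : HyperExt Y M i} (hf : x • f = 0) : f = 0 := by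
  have := ModuleCat.isIso_smul_id hx
  rw [← map_id f, ← IsIso.hom_inv_id (x • 𝟙 M), map_comp, map_smul_id, hf, map_zero]

theorem exists_smul_eq {x : R} (hx : Function.Bijective fun m : M => x • m)
    (f : HyperExt Y M i) : ∃ g, x • g = f := by
  have := ModuleCat.isIso_smul_id hx
  refine ⟨map (inv (x • 𝟙 M)) f, ?_⟩
  rw [← map_smul_id, ← map_comp, IsIso.inv_hom_id, map_id]

end HyperExt

/-- The single complex attached to a module. -/
noncomputable abbrev singleObj (N : ModuleCat.{u} R) : DerivedCategory (ModuleCat.{u} R) :=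
  (DerivedCategory.singleFunctor (ModuleCat.{u} R) 0).obj N

theorem HyperExt.smul_eq_zero_of_single {x : R} {n : ℕ} (hx : ∀ z : N, x ^ n • z = 0)
    (f : HyperExt (singleObj N) M i) : x ^ n • f = 0 := by
  have h : x ^ n • 𝟙 N = 0 := ModuleCat.hom_ext (LinearMap.ext hx)
  have h' : x ^ n • 𝟙 (singleObj N) = 0 := by
    rw [← CategoryTheory.Functor.map_id, ← Functor.map_smul, h, Functor.map_zero]
  rw [← Category.id_comp f, ← Linear.smul_comp, h', zero_comp]

/-- Objects of the derived category that are orthogonal to modules on which some element of `s`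
is invertible, and which are connective. -/
structure IsTorsionTest (s : Set R) (Y : DerivedCategory (ModuleCat.{u} R)) : Prop where
  eq_zero_of_bijective : ∀ (M : ModuleCat.{u} R), ∀ x ∈ s,
    (Function.Bijective fun m : M => x • m) → ∀ (i : ℤ) (f : HyperExt Y M i), f = 0
  eq_zero_of_neg : ∀ (M : ModuleCat.{u} R) (i : ℤ), i < 0 → ∀ f : HyperExt Y M i, f = 0

theorem HyperExt.eq_zero_of_single_of_neg (hi : i < 0) (f : HyperExt (singleObj N) M i) :
    f = 0 := by
  have : (DerivedCategory.TStructure.t (C := ModuleCat.{u} R)).IsGE ((singleObj M)⟦i⟧) (-i) :=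
    DerivedCategory.TStructure.t.isGE_shift _ 0 i (-i)
  exact DerivedCategory.TStructure.t.zero_of_isLE_of_isGE f 0 (-i) (by lia) inferInstance this

theorem isTorsionTest_single {s : Set R} {N : ModuleCat.{u} R}
    (hN : ∀ x ∈ s, ∃ n : ℕ, ∀ z : N, x ^ n • z = 0) : IsTorsionTest s (singleObj N) where
  eq_zero_of_bijective M x hx hb i f := by
    obtain ⟨n, hn⟩ := hN x hx
    refine HyperExt.eq_zero_of_smul_eq_zero (x := x ^ n) ?_ (HyperExt.smul_eq_zero_of_single hn f)
    clear hn
    induction n with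
    | zero => simp only [pow_zero, one_smul]; exact Function.bijective_id
    | succ n ih => simp only [pow_succ, mul_smul]; exact ih.comp hb
  eq_zero_of_neg M i hi f := HyperExt.eq_zero_of_single_of_neg hi f

section LongExactSequence

variable {S : ShortComplex (ModuleCat.{u} R)} (hS : S.ShortExact)

/-- The class of a short exact sequence in the derived category. -/
noncomputable abbrev shortExactDelta :
    ShiftedHom (singleObj S.X₃) (singleObj S.X₁) (1 : ℤ) := hS.singleδ

/-- The connecting map of the long exact sequence of hyper-Ext groups. -/
noncomputable def HyperExt.delta {i j : ℤ} (h : 1 + i = j) (f : HyperExt Y S.X₃ i) :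
    HyperExt Y S.X₁ j :=
  f.comp (shortExactDelta hS) h

namespace HyperExt

variable {j : ℤ}

theorem exists_map_f_eq {S : ShortComplex (ModuleCat.{u} R)} (hS : S.ShortExact)
    (f : HyperExt Y S.X₂ i) (hf : map S.g f = 0) :
    ∃ g : HyperExt Y S.X₁ i, map S.f g = f :=
  exists_comp_mor₁_of_distTriang hS.singleTriangle_distinguished f hf

theorem exists_map_g_eq (h : 1 + i = j) (f : HyperExt Y S.X₃ i) (hf : delta hS h f = 0) :
    ∃ g : HyperExt Y S.X₂ i, map S.g g = f :=
  exists_comp_mor₂_of_distTriang hS.singleTriangle_distinguished h f hf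

theorem exists_delta_eq (h : 1 + i = j) (f : HyperExt Y S.X₁ j) (hf : map S.f f = 0) :
    ∃ g : HyperExt Y S.X₃ i, delta hS h g = f :=
  exists_comp_mor₃_of_distTriang hS.singleTriangle_distinguished h f hf

theorem delta_sub (h : 1 + i = j) (f g : HyperExt Y S.X₃ i) :
    delta hS h (f - g) = delta hS h f - delta hS h g := by
  simp only [delta, sub_eq_add_neg, ShiftedHom.add_comp, ShiftedHom.neg_comp]

theorem delta_zero (h : 1 + i = j) : delta hS h (0 : HyperExt Y S.X₃ i) = 0 := by
  simp only [delta, ShiftedHom.zero_comp]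

end HyperExt

end LongExactSequence

end HyperExt

section LocalizationProduct

variable {R : Type u} [CommRing R]

theorem bijective_smul_localizedModule_powers (x : R) (M : Type*) [AddCommGroup M] [Module R M] :
    Function.Bijective fun m : LocalizedModule (Submonoid.powers x) M => x • m := by
  have h := IsLocalizedModule.map_units
    (LocalizedModule.mkLinearMap (Submonoid.powers x) M) ⟨x, Submonoid.mem_powers x⟩
  exact (Module.End.isUnit_iff _).1 h

/-- The product of the localizations of `M` at the elements of `s`. -/
noncomputable abbrev localizationProduct (s : Finset R) (M : ModuleCat.{u} R) : ModuleCat.{u} R :=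
  ModuleCat.of R (∀ x : s, LocalizedModule (Submonoid.powers (x : R)) M)

/-- The canonical map to the product of localizations. -/
noncomputable def toLocalizationProduct (s : Finset R) (M : ModuleCat.{u} R) :
    M →ₗ[R] localizationProduct s M :=
  LinearMap.pi fun x => LocalizedModule.mkLinearMap (Submonoid.powers (x : R)) M

theorem toLocalizationProduct_injective {s : Finset R} {M : ModuleCat.{u} R}
    (hM : ExtSystemVanishes (Ideal.span (s : Set R)) M 0) :
    Function.Injective (toLocalizationProduct s M) := by
  rw [injective_iff_map_eq_zero]
  intro z hz
  have hle : Ideal.span (s : Set R) ≤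
      Ideal.radical (LinearMap.ker (LinearMap.toSpanSingleton R M z)) := by
    refine Ideal.span_le.2 fun x hx => ?_
    have h : LocalizedModule.mkLinearMap (Submonoid.powers x) M z = 0 := congrFun hz ⟨x, hx⟩
    obtain ⟨⟨_, n, rfl⟩, hc⟩ := (IsLocalizedModule.eq_zero_iff (Submonoid.powers x) _).1 h
    exact ⟨n, hc⟩
  obtain ⟨n, hn⟩ := Ideal.exists_pow_le_of_le_radical_of_fg hle ⟨s, rfl⟩
  exact hM.eq_zero_of_pow_smul (n := n) fun r hr => hn hr

theorem toLocalizationProduct_shortExact {s : Finset R} {M : ModuleCat.{u} R}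
    (hM : ExtSystemVanishes (Ideal.span (s : Set R)) M 0) :
    (LinearMap.exact_map_mkQ_range
      (toLocalizationProduct s M)).moduleCatShortComplex.ShortExact :=
  Function.Exact.moduleCatShortComplex_shortExact _ (toLocalizationProduct_injective hM)
    (Submodule.mkQ_surjective _)

variable [HasDerivedCategory.{w} (ModuleCat.{u} R)]

theorem IsTorsionTest.eq_zero_localizationProduct {s : Finset R}
    {Y : DerivedCategory (ModuleCat.{u} R)} (hY : IsTorsionTest (s : Set R) Y)
    (M : ModuleCat.{u} R) (i : ℤ) (f : HyperExt Y (localizationProduct s M) i) : f = 0 := by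
  let X (x : s) : ModuleCat.{u} R := ModuleCat.of R (LocalizedModule (Submonoid.powers (x : R)) M)
  let p (x : s) : localizationProduct s M ⟶ X x := ModuleCat.ofHom (LinearMap.proj x)
  let q (x : s) : X x ⟶ localizationProduct s M := ModuleCat.ofHom
    (LinearMap.single R (fun x : s => LocalizedModule (Submonoid.powers (x : R)) M) x)
  have h : 𝟙 (localizationProduct s M) = ∑ x : s, p x ≫ q x := by
    refine ModuleCat.hom_ext ?_
    rw [ModuleCat.hom_sum]
    refine LinearMap.ext fun z => ?_
    rw [LinearMap.sum_apply]
    exact (LinearMap.sum_single_apply _ z).symm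
  rw [← HyperExt.map_id f, h, HyperExt.map_sum_hom]
  refine Finset.sum_eq_zero fun x _ => ?_
  rw [HyperExt.map_comp, hY.eq_zero_of_bijective (X x) x x.2
    (bijective_smul_localizedModule_powers _ _) i (HyperExt.map (p x) f), HyperExt.map_zero]

theorem extSystemVanishes_of_hyperExt {s : Finset R} {M : ModuleCat.{u} R} (i : ℕ)
    (h : ∀ Y : DerivedCategory (ModuleCat.{u} R), IsTorsionTest (s : Set R) Y →
      ∀ f : HyperExt Y M i, f = 0) : ExtSystemVanishes (Ideal.span (s : Set R)) M i := by
  intro n ξ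
  have : ξ = 0 := by
    have ht : IsTorsionTest (s : Set R)
        (singleObj (ModuleCat.of R (R ⧸ Ideal.span (s : Set R) ^ n))) := by
      refine isTorsionTest_single fun x hx => ⟨n, fun z => ?_⟩
      obtain ⟨z, rfl⟩ := Submodule.mkQ_surjective _ z
      rw [← map_smul, Submodule.mkQ_apply, Submodule.Quotient.mk_eq_zero]
      exact Ideal.mul_mem_right _ _ (Ideal.pow_mem_pow (Ideal.subset_span hx) n)
    exact Ext.homEquiv.injective ((h _ ht _).trans (h _ ht _).symm)
  exact ⟨n, le_rfl, by rw [this, Ext.comp_zero]⟩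

theorem extSystemVanishes_localizationProduct (s : Finset R) (M : ModuleCat.{u} R) (i : ℕ) :
    ExtSystemVanishes (Ideal.span (s : Set R)) (localizationProduct s M) i :=
  extSystemVanishes_of_hyperExt i fun _ hY f => hY.eq_zero_localizationProduct M i f

/-- The cokernel of the map to the product of localizations. -/
noncomputable abbrev localizationCokernel (s : Finset R) (M : ModuleCat.{u} R) : ModuleCat.{u} R :=
  ModuleCat.of R ((localizationProduct s M) ⧸ LinearMap.range (toLocalizationProduct s M))

theorem extSystemVanishes_localizationCokernel {s : Finset R} {M : ModuleCat.{u} R}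
    (hM : ExtSystemVanishes (Ideal.span (s : Set R)) M 0) {i : ℕ}
    (hi : ExtSystemVanishes (Ideal.span (s : Set R)) M (i + 1)) :
    ExtSystemVanishes (Ideal.span (s : Set R)) (localizationCokernel s M) i :=
  ExtSystemVanishes.of_shortExact₃ (toLocalizationProduct_shortExact hM)
    (extSystemVanishes_localizationProduct s M i) hi

theorem bijective_delta_toLocalizationProduct {s : Finset R} {M : ModuleCat.{u} R}
    (hM : ExtSystemVanishes (Ideal.span (s : Set R)) M 0)
    {Y : DerivedCategory (ModuleCat.{u} R)} (hY : IsTorsionTest (s : Set R) Y) {i j : ℤ}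
    (h : 1 + i = j) :
    Function.Bijective fun f : HyperExt Y (localizationCokernel s M) i =>
      (HyperExt.delta (toLocalizationProduct_shortExact hM) h f : HyperExt Y M j) := by
  have hS := toLocalizationProduct_shortExact hM
  refine ⟨fun f g hfg => ?_, fun f => HyperExt.exists_delta_eq hS h f
    (hY.eq_zero_localizationProduct M j _)⟩
  have h0 : HyperExt.delta hS h (f - g) = 0 := by
    rw [HyperExt.delta_sub, sub_eq_zero]
    exact hfg
  obtain ⟨e, he⟩ := HyperExt.exists_map_g_eq hS h (f - g) h0
  rw [hY.eq_zero_localizationProduct M i e, HyperExt.map_zero] at he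
  exact sub_eq_zero.1 he.symm

theorem IsTorsionTest.eq_zero_of_extSystemVanishes {s : Finset R} {M : ModuleCat.{u} R}
    (hM : ∀ i, ExtSystemVanishes (Ideal.span (s : Set R)) M i)
    {Y : DerivedCategory (ModuleCat.{u} R)} (hY : IsTorsionTest (s : Set R) Y) (i : ℤ)
    (f : HyperExt Y M i) : f = 0 := by
  obtain ⟨n, hn⟩ : ∃ n : ℕ, i < n := ⟨(i + 1).toNat, by lia⟩
  induction n generalizing M i with
  | zero => exact hY.eq_zero_of_neg M i hn f
  | succ n ih =>
    obtain ⟨g, hg⟩ := (bijective_delta_toLocalizationProduct (hM 0) hY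
      (show 1 + (i - 1) = i by ring)).2 f
    obtain ⟨g', hg'⟩ := (bijective_delta_toLocalizationProduct (hM 0) hY
      (show 1 + (i - 1) = i by ring)).2 (0 : HyperExt Y M i)
    have := ih (fun i => extSystemVanishes_localizationCokernel (hM 0) (hM (i + 1))) (i - 1) g
      (by lia)
    have := ih (fun i => extSystemVanishes_localizationCokernel (hM 0) (hM (i + 1))) (i - 1) g'
      (by lia)
    simp_all

end LocalizationProduct

section Representation

variable {R : Type u} [CommRing R]

/-- The submodule of elements killed by a power of `K`. -/
def powTorsion (K : Ideal R) (M : Type*) [AddCommGroup M] [Module R M] : Submodule R M where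
  carrier := {z | ∃ n : ℕ, ∀ r ∈ K ^ n, r • z = 0}
  zero_mem' := ⟨0, fun r _ => smul_zero r⟩
  add_mem' := by
    rintro a b ⟨n, hn⟩ ⟨m, hm⟩
    refine ⟨n + m, fun r hr => ?_⟩
    rw [smul_add, hn r (Ideal.pow_le_pow_right (Nat.le_add_right n m) hr),
      hm r (Ideal.pow_le_pow_right (Nat.le_add_left m n) hr), add_zero]
  smul_mem' := by
    rintro c x ⟨n, hn⟩
    exact ⟨n, fun r hr => by rw [smul_comm, hn r hr, smul_zero]⟩

theorem isPowTorsion_powTorsion (K : Ideal R) (M : Type*) [AddCommGroup M] [Module R M] :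
    IsPowTorsion K (powTorsion K M) := by
  rintro ⟨z, n, hn⟩
  exact ⟨n, fun r hr => Subtype.ext (hn r hr)⟩

theorem mem_powTorsion_of_forall_mem [IsNoetherianRing R] {K : Ideal R} {M : Type*}
    [AddCommGroup M] [Module R M] {n : ℕ} {z : M} (hz : ∀ r ∈ K ^ n, r • z ∈ powTorsion K M) :
    z ∈ powTorsion K M := by
  let φ : (K ^ n : Ideal R) →ₗ[R] powTorsion K M :=
    ((LinearMap.toSpanSingleton R M z).comp (K ^ n).subtype).codRestrict _ fun r => hz r r.2
  have hfg : (LinearMap.range φ).FG := by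
    rw [LinearMap.range_eq_map]
    exact Submodule.FG.map φ (Module.Finite.fg_top)
  obtain ⟨m, hm⟩ := (isPowTorsion_powTorsion K M).exists_forall_of_fg hfg
  refine ⟨m + n, fun r hr => ?_⟩
  rw [pow_add] at hr
  induction hr using Submodule.mul_induction_on' with
  | mem_mul_mem a ha b hb =>
    have := congrArg Subtype.val (hm a ha (φ ⟨b, hb⟩) ⟨_, rfl⟩)
    rw [mul_smul]
    exact this
  | add a _ b _ ha hb => rw [add_smul, ha, hb, add_zero]

theorem powTorsion_shortExact (K : Ideal R) (M : ModuleCat.{u} R) :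
    (LinearMap.exact_subtype_mkQ (powTorsion K M)).moduleCatShortComplex.ShortExact :=
  Function.Exact.moduleCatShortComplex_shortExact _ (Submodule.subtype_injective _)
    (Submodule.mkQ_surjective _)

theorem extSystemVanishes_quotient_powTorsion [IsNoetherianRing R] {K : Ideal R}
    {M : ModuleCat.{u} R} (hM : ∀ i, i ≠ 0 → ExtSystemVanishes K M i) (i : ℕ) :
    ExtSystemVanishes K (ModuleCat.of R (M ⧸ powTorsion K M)) i := by
  obtain rfl | hi := eq_or_ne i 0
  · refine extSystemVanishes_zero fun n z hz => ?_
    obtain ⟨z, rfl⟩ := Submodule.mkQ_surjective _ z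
    rw [Submodule.mkQ_apply, Submodule.Quotient.mk_eq_zero]
    refine mem_powTorsion_of_forall_mem (n := n) fun r hr => ?_
    have := hz r hr
    rwa [← map_smul, Submodule.mkQ_apply, Submodule.Quotient.mk_eq_zero] at this
  · exact ExtSystemVanishes.of_shortExact₃ (powTorsion_shortExact K M) (hM i hi)
      (IsPowTorsion.extSystemVanishes_succ (isPowTorsion_powTorsion K M) i)

variable [HasDerivedCategory.{w} (ModuleCat.{u} R)]

theorem bijective_map_powTorsion [IsNoetherianRing R] {s : Finset R}
    {M : ModuleCat.{u} R} (hM : ∀ i, i ≠ 0 → ExtSystemVanishes (Ideal.span (s : Set R)) M i)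
    {Y : DerivedCategory (ModuleCat.{u} R)} (hY : IsTorsionTest (s : Set R) Y) (i : ℤ) :
    Function.Bijective fun f : HyperExt Y (ModuleCat.of R (powTorsion (Ideal.span (s : Set R)) M)) i
      => HyperExt.map (ModuleCat.ofHom (Submodule.subtype _)) f := by
  have hS := powTorsion_shortExact (Ideal.span (s : Set R)) M
  have h0 := hY.eq_zero_of_extSystemVanishes (extSystemVanishes_quotient_powTorsion hM)
  refine ⟨fun f g hfg => ?_, fun f => HyperExt.exists_map_f_eq hS f (h0 i _)⟩
  have hz : HyperExt.map (ModuleCat.ofHom (Submodule.subtype _)) (f - g) = 0 := by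
    rw [HyperExt.map_sub, sub_eq_zero]
    exact hfg
  obtain ⟨e, he⟩ := HyperExt.exists_delta_eq hS (show 1 + (i - 1) = i by ring) (f - g) hz
  rw [h0 _ e, HyperExt.delta_zero] at he
  exact sub_eq_zero.1 he.symm

/-- If the only nonvanishing `Ext` system of `M` sits in degree `h`, then hyper-Ext groups of `M`
against test objects are computed by a single torsion module. -/
theorem exists_torsion_representation [IsNoetherianRing R] {s : Finset R} (h : ℕ)
    {M : ModuleCat.{u} R} (hM : ∀ i, i ≠ h → ExtSystemVanishes (Ideal.span (s : Set R)) M i) :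
    ∃ (H : ModuleCat.{u} R) (_ : IsPowTorsion (Ideal.span (s : Set R)) H)
      (ε : ShiftedHom (singleObj H) (singleObj M) (h : ℤ)),
      ∀ Y : DerivedCategory (ModuleCat.{u} R), IsTorsionTest (s : Set R) Y →
        ∀ (i j : ℤ) (hij : h + i = j), Function.Bijective fun f : HyperExt Y H i =>
          (ShiftedHom.comp f ε hij : HyperExt Y M j) := by
  induction h generalizing M with
  | zero =>
    refine ⟨ModuleCat.of R (powTorsion (Ideal.span (s : Set R)) M), isPowTorsion_powTorsion _ _,
      ShiftedHom.mk₀ _ Nat.cast_zero ((DerivedCategory.singleFunctor (ModuleCat.{u} R) 0).map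
        (ModuleCat.ofHom (Submodule.subtype _))), fun Y hY i j hij => ?_⟩
    obtain rfl : i = j := by simpa using hij
    simp only [ShiftedHom.comp_mk₀]
    exact bijective_map_powTorsion hM hY i
  | succ h ih =>
    obtain ⟨H, hH, ε, hε⟩ := ih (M := localizationCokernel s M) fun i hi =>
      extSystemVanishes_localizationCokernel (hM 0 (by lia)) (hM (i + 1) (by lia))
    have hS := toLocalizationProduct_shortExact (hM 0 (by lia))
    refine ⟨H, hH, ShiftedHom.comp ε (shortExactDelta hS) (by push_cast; ring),
      fun Y hY i j hij => ?_⟩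
    have h₁ := hε Y hY i (h + i) rfl
    have h₂ := bijective_delta_toLocalizationProduct (hM 0 (by lia)) hY
      (show 1 + ((h : ℤ) + i) = j by rw [← hij]; push_cast; ring)
    convert h₂.comp h₁ using 1
    funext f
    exact (ShiftedHom.comp_assoc f ε (shortExactDelta hS) rfl (by push_cast; ring)
      (by rw [← hij]; push_cast; ring)).symm

end Representation

section Koszul

variable {R : Type u} [CommRing R] [HasDerivedCategory.{w} (ModuleCat.{u} R)]

theorem HyperExt.exists_eq_mk₀ {N M : ModuleCat.{u} R} (f : HyperExt (singleObj N) M 0) :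
    ∃ φ : N ⟶ M, f = ShiftedHom.mk₀ (0 : ℤ) rfl
      ((DerivedCategory.singleFunctor (ModuleCat.{u} R) 0).map φ) := by
  obtain ⟨ξ, hξ⟩ := (Ext.homEquiv (X := N) (Y := M) (n := 0)).surjective f
  obtain ⟨φ, rfl⟩ := (Ext.mk₀_bijective N M).2 ξ
  exact ⟨φ, hξ.symm.trans (Ext.mk₀_hom φ)⟩

theorem HyperExt.eq_zero_of_projective_of_pos {N M : ModuleCat.{u} R} [Projective N] {i : ℤ}
    (hi : 0 < i) (f : HyperExt (singleObj N) M i) : f = 0 := by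
  obtain ⟨n, rfl⟩ : ∃ n : ℕ, i = (n + 1 : ℕ) := ⟨(i - 1).toNat, by lia⟩
  obtain ⟨ξ, rfl⟩ := (Ext.homEquiv (X := N) (Y := M) (n := n + 1)).surjective f
  rw [Ext.eq_zero_of_projective ξ]
  exact Ext.zero_hom ..

/-- The properties of the Koszul complex of `l` that characterize its hyper-Ext groups well enough
to detect the quotient of `R` by `l`. -/
structure IsKoszulObject (l : List R) (P : DerivedCategory (ModuleCat.{u} R)) : Prop where
  eq_zero_of_neg : ∀ (M : ModuleCat.{u} R) (i : ℤ), i < 0 → ∀ f : HyperExt P M i, f = 0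
  eq_zero_of_length_lt : ∀ (M : ModuleCat.{u} R) (i : ℤ), l.length < i →
    ∀ f : HyperExt P M i, f = 0
  exists_pow_smul_eq_zero : ∀ (M : ModuleCat.{u} R) (y : R), (∀ z : M, ∃ m : ℕ, y ^ m • z = 0) →
    ∀ (i : ℤ) (f : HyperExt P M i), ∃ m : ℕ, y ^ m • f = 0
  eq_zero_of_bijective : ∀ (M : ModuleCat.{u} R), ∀ x ∈ l,
    (Function.Bijective fun m : M => x • m) → ∀ (i : ℤ) (f : HyperExt P M i), f = 0
  exists_generator : ∃ g : HyperExt P (ModuleCat.of R R) l.length,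
    (∀ f : HyperExt P (ModuleCat.of R R) l.length, ∃ r : R, f = r • g) ∧
      ∀ r : R, r • g = 0 → r ∈ Ideal.span {x | x ∈ l}

theorem isKoszulObject_nil : IsKoszulObject ([] : List R) (singleObj (ModuleCat.of R R)) where
  eq_zero_of_neg M i hi f := HyperExt.eq_zero_of_single_of_neg hi f
  eq_zero_of_length_lt M i hi f := by
    have : Projective (ModuleCat.of R R) := (IsProjective.iff_projective R).1 inferInstance
    exact HyperExt.eq_zero_of_projective_of_pos hi f
  exists_pow_smul_eq_zero M y hy i f := by
    have : Projective (ModuleCat.of R R) := (IsProjective.iff_projective R).1 inferInstance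
    rcases lt_trichotomy i 0 with hi | rfl | hi
    · exact ⟨0, by rw [HyperExt.eq_zero_of_single_of_neg hi f, smul_zero]⟩
    · obtain ⟨φ, rfl⟩ := HyperExt.exists_eq_mk₀ f
      obtain ⟨m, hm⟩ := hy (φ.hom 1)
      refine ⟨m, ?_⟩
      have : y ^ m • φ = 0 := by
        refine ModuleCat.hom_ext (LinearMap.ext_ring ?_)
        exact hm
      rw [← ShiftedHom.mk₀_smul, ← Functor.map_smul, this, Functor.map_zero, ShiftedHom.mk₀_zero]
    · exact ⟨0, by rw [HyperExt.eq_zero_of_projective_of_pos hi f, smul_zero]⟩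
  eq_zero_of_bijective M x hx := by simp at hx
  exists_generator := by
    refine ⟨ShiftedHom.mk₀ (0 : ℤ) rfl
      ((DerivedCategory.singleFunctor (ModuleCat.{u} R) 0).map (𝟙 _)), fun f => ?_, fun r hr => ?_⟩
    · obtain ⟨φ, rfl⟩ := HyperExt.exists_eq_mk₀ f
      refine ⟨φ.hom 1, ?_⟩
      have : φ = (φ.hom (1 : R) : R) • 𝟙 (ModuleCat.of R R) := by
        refine ModuleCat.hom_ext (LinearMap.ext_ring ?_)
        exact (mul_one (φ.hom (1 : R) : R)).symm
      rw [← ShiftedHom.mk₀_smul, ← Functor.map_smul, ← this]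
    · rw [← ShiftedHom.mk₀_smul, ← Functor.map_smul] at hr
      have h0 := (ShiftedHom.homEquiv (0 : ℤ) rfl).injective
        (hr.trans (ShiftedHom.mk₀_zero _ _ (0 : ℤ) rfl).symm)
      have := (DerivedCategory.singleFunctor (ModuleCat.{u} R) 0).map_injective
        (h0.trans (Functor.map_zero ..).symm)
      have h1 : r • (1 : R) = 0 := congrArg (fun φ : ModuleCat.of R R ⟶ ModuleCat.of R R =>
        φ.hom (1 : R)) this
      rw [smul_eq_mul, mul_one] at h1
      exact h1 ▸ zero_mem _

theorem exists_isKoszulObject_cons {l : List R} {P : DerivedCategory (ModuleCat.{u} R)}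
    (hP : IsKoszulObject l P) (x : R) : ∃ Q, IsKoszulObject (x :: l) Q := by
  obtain ⟨Q, p, d, hT⟩ := Pretriangulated.distinguished_cocone_triangle (x • 𝟙 P)
  set T := Pretriangulated.Triangle.mk (x • 𝟙 P) p d with hTdef
  let δ : ShiftedHom Q P (1 : ℤ) := d
  have hδ {M : ModuleCat.{u} R} {i : ℤ} (f : HyperExt Q M (i + 1)) (hf : p ≫ f = 0) :
      ∃ g : HyperExt P M i, δ.comp g rfl = f :=
    exists_mor₃_comp_of_distTriang hT rfl f hf
  have hδ₀ {M : ModuleCat.{u} R} {i : ℤ} (g : HyperExt P M i)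
      (hg : δ.comp g (rfl : i + 1 = i + 1) = 0) : ∃ e : HyperExt P M i, x • e = g := by
    obtain ⟨e, he⟩ : ∃ e : HyperExt P M i, (x • 𝟙 P) ≫ e = g :=
      exists_mor₁_comp_of_distTriang hT rfl g hg
    exact ⟨e, by rw [← he, Linear.smul_comp, Category.id_comp]⟩
  have hδx {M : ModuleCat.{u} R} {i : ℤ} (e : HyperExt P M i) :
      δ.comp (x • e : HyperExt P M i) (rfl : i + 1 = i + 1) = 0 := by
    have h : δ.comp ((x • 𝟙 P) ≫ e : HyperExt P M i) (rfl : i + 1 = i + 1) = 0 :=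
      mor₁_comp_mor₃_of_distTriang hT rfl e
    rwa [Linear.smul_comp, Category.id_comp] at h
  have hp {M : ModuleCat.{u} R} {i : ℤ} (f : HyperExt Q M i) :
      x • (p ≫ f : HyperExt P M i) = 0 := by
    have h : (x • 𝟙 P) ≫ p = 0 := Pretriangulated.comp_distTriang_mor_zero₁₂ T hT
    rw [← Category.id_comp (p ≫ f), ← Linear.smul_comp, ← Category.assoc, h, zero_comp]
  refine ⟨Q, ?_, ?_, ?_, ?_, ?_⟩
  · intro M i hi f
    obtain ⟨i, rfl⟩ : ∃ j, i = j + 1 := ⟨i - 1, by ring⟩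
    obtain ⟨g, rfl⟩ := hδ f (hP.eq_zero_of_neg M _ hi _)
    rw [hP.eq_zero_of_neg M i (by lia) g, ShiftedHom.comp_zero]
  · intro M i hi f
    obtain ⟨i, rfl⟩ : ∃ j, i = j + 1 := ⟨i - 1, by ring⟩
    rw [List.length_cons] at hi
    obtain ⟨g, rfl⟩ := hδ f (hP.eq_zero_of_length_lt M _ (by lia) _)
    rw [hP.eq_zero_of_length_lt M i (by lia) g, ShiftedHom.comp_zero]
  · intro M y hy i f
    obtain ⟨i, rfl⟩ : ∃ j, i = j + 1 := ⟨i - 1, by ring⟩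
    obtain ⟨m, hm⟩ := hP.exists_pow_smul_eq_zero M y hy _ (p ≫ f)
    obtain ⟨g, hg⟩ := hδ (y ^ m • f) (by rw [Linear.comp_smul, hm])
    obtain ⟨n, hn⟩ := hP.exists_pow_smul_eq_zero M y hy _ g
    refine ⟨n + m, ?_⟩
    rw [pow_add, mul_smul, ← hg, ← ShiftedHom.comp_smul, hn, ShiftedHom.comp_zero]
  · intro M a ha hb i f
    obtain ⟨i, rfl⟩ : ∃ j, i = j + 1 := ⟨i - 1, by ring⟩
    obtain rfl | ha := List.mem_cons.1 ha
    · obtain ⟨g, rfl⟩ := hδ f (HyperExt.eq_zero_of_smul_eq_zero hb (hp f))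
      obtain ⟨e, rfl⟩ := HyperExt.exists_smul_eq hb g
      exact hδx e
    · obtain ⟨g, rfl⟩ := hδ f (hP.eq_zero_of_bijective M a ha hb _ _)
      rw [hP.eq_zero_of_bijective M a ha hb _ g, ShiftedHom.comp_zero]
  · obtain ⟨g, hg, hg'⟩ := hP.exists_generator
    have hlen : ((x :: l).length : ℤ) = l.length + 1 := by simp
    rw [hlen]
    refine ⟨δ.comp g rfl, fun f => ?_, fun r hr => ?_⟩
    · obtain ⟨g₁, rfl⟩ := hδ f (hP.eq_zero_of_length_lt _ _ (by lia) _)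
      obtain ⟨r, rfl⟩ := hg g₁
      exact ⟨r, ShiftedHom.comp_smul ..⟩
    · rw [← ShiftedHom.comp_smul] at hr
      obtain ⟨e, he⟩ := hδ₀ _ hr
      obtain ⟨r', rfl⟩ := hg e
      have h := hg' (r - x * r') (by rw [sub_smul, mul_smul, he, sub_self])
      have hx : x ∈ Ideal.span {a | a ∈ x :: l} := Ideal.subset_span (List.mem_cons_self ..)
      rw [← sub_add_cancel r (x * r')]
      refine add_mem (Ideal.span_mono (fun a ha => List.mem_cons_of_mem _ ha) h)
        (Ideal.mul_mem_right _ _ hx)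

theorem exists_isKoszulObject (l : List R) :
    ∃ P : DerivedCategory (ModuleCat.{u} R), IsKoszulObject l P := by
  induction l with
  | nil => exact ⟨_, isKoszulObject_nil⟩
  | cons x l ih => exact exists_isKoszulObject_cons ih.choose_spec x

theorem IsKoszulObject.isTorsionTest {l : List R} {P : DerivedCategory (ModuleCat.{u} R)}
    (hP : IsKoszulObject l P) : IsTorsionTest {x | x ∈ l} P where
  eq_zero_of_bijective := hP.eq_zero_of_bijective
  eq_zero_of_neg := hP.eq_zero_of_neg

end Koszul

section Decomposition

variable {R : Type u} [CommRing R]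

theorem Ideal.exists_pow_inf_pow_le [IsNoetherianRing R] (I J : Ideal R) (m : ℕ) :
    ∃ a : ℕ, I ^ a ⊓ J ^ a ≤ (I ⊓ J) ^ m := by
  obtain ⟨k, hk⟩ := Ideal.exists_pow_inf_eq_pow_smul I (J ^ m : Ideal R)
  refine ⟨k + m, ?_⟩
  calc I ^ (k + m) ⊓ J ^ (k + m) ≤ I ^ (k + m) • ⊤ ⊓ J ^ m := by
        rw [smul_eq_mul, Ideal.mul_top]
        exact inf_le_inf_left _ (Ideal.pow_le_pow_right (Nat.le_add_left m k))
    _ = I ^ m • (I ^ k • ⊤ ⊓ J ^ m) := by rw [hk _ (Nat.le_add_right k m), Nat.add_sub_cancel_left]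
    _ ≤ I ^ m * J ^ m := Ideal.mul_mono_right inf_le_right
    _ ≤ (I ⊓ J) ^ m := by
        rw [← mul_pow]
        exact Ideal.pow_right_mono Ideal.mul_le_inf m

theorem isCompl_powTorsion [IsNoetherianRing R] {I J : Ideal R} {H : Type*} [AddCommGroup H]
    [Module R H] (hH : IsPowTorsion (I ⊓ J) H)
    (h₀ : ∀ (a : ℕ) (z : H), (∀ r ∈ I ^ a ⊔ J ^ a, r • z = 0) → z = 0)
    (h₁ : ∀ (a : ℕ) (φ : (I ^ a ⊔ J ^ a : Ideal R) →ₗ[R] H), ∃ z : H, ∀ r, φ r = (r : R) • z) :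
    IsCompl (powTorsion I H) (powTorsion J H) := by
  refine ⟨Submodule.disjoint_def.2 ?_, Submodule.codisjoint_iff_exists_add_eq.2 fun z => ?_⟩
  · rintro z ⟨n, hn⟩ ⟨m, hm⟩
    refine h₀ (n + m) z fun r hr => ?_
    obtain ⟨x, hx, y, hy, rfl⟩ := Submodule.mem_sup.1 hr
    rw [add_smul, hn x (Ideal.pow_le_pow_right (Nat.le_add_right n m) hx),
      hm y (Ideal.pow_le_pow_right (Nat.le_add_left m n) hy), add_zero]
  · obtain ⟨m, hm⟩ := hH z
    obtain ⟨a, ha⟩ := Ideal.exists_pow_inf_pow_le I J m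
    let f : R →ₗ.[R] H := ⟨I ^ a, (LinearMap.toSpanSingleton R H z).comp (I ^ a).subtype⟩
    let g : R →ₗ.[R] H := ⟨J ^ a, 0⟩
    have hfg (x : f.domain) (y : g.domain) (hxy : (x : R) = y) : f x = g y :=
      hm x (ha ⟨x.2, hxy ▸ y.2⟩)
    obtain ⟨w, hw⟩ := h₁ a (f.sup g hfg).toFun
    have hwI (r : R) (hr : r ∈ I ^ a) : r • z = r • w :=
      ((f.left_le_sup g hfg).2 (x := ⟨r, hr⟩) (y := ⟨r, Submodule.mem_sup_left hr⟩) rfl).trans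
        (hw ⟨r, Submodule.mem_sup_left hr⟩)
    have hwJ (r : R) (hr : r ∈ J ^ a) : (0 : H) = r • w :=
      ((f.right_le_sup g hfg).2 (x := ⟨r, hr⟩) (y := ⟨r, Submodule.mem_sup_right hr⟩) rfl).trans
        (hw ⟨r, Submodule.mem_sup_right hr⟩)
    exact ⟨z - w, w, ⟨a, fun r hr => by rw [smul_sub, hwI r hr, sub_self]⟩,
      ⟨a, fun r hr => (hwJ r hr).symm⟩, sub_add_cancel z w⟩

theorem eq_zero_of_subsingleton_ext_quotient (L : Ideal R) (H : ModuleCat.{u} R)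
    (hs : Subsingleton (Ext (ModuleCat.of R (R ⧸ L)) H 0)) (z : H) (hz : ∀ r ∈ L, r • z = 0) :
    z = 0 := by
  let φ : ModuleCat.of R (R ⧸ L) ⟶ H :=
    ModuleCat.ofHom (L.liftQ (LinearMap.toSpanSingleton R H z) fun r hr => hz r hr)
  have hφ : φ = 0 := (Ext.mk₀_bijective _ _).1 (Subsingleton.elim _ _)
  have h1 : (1 : R) • z = 0 := congrArg (fun ψ : ModuleCat.of R (R ⧸ L) ⟶ H =>
    ψ.hom (Submodule.Quotient.mk 1)) hφ
  rwa [one_smul] at h1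

theorem exists_smul_of_subsingleton_ext_quotient (L : Ideal R) (H : ModuleCat.{u} R)
    (hs : Subsingleton (Ext (ModuleCat.of R (R ⧸ L)) H 1)) (φ : L →ₗ[R] H) :
    ∃ z : H, ∀ r, φ r = (r : R) • z := by
  have hS := (LinearMap.exact_subtype_mkQ L).moduleCatShortComplex_shortExact
    (Submodule.subtype_injective _) (Submodule.mkQ_surjective _)
  obtain ⟨ξ, hξ⟩ := Ext.contravariant_sequence_exact₁ hS H (Ext.mk₀ (ModuleCat.ofHom φ)) rfl
    (hs.elim _ _)
  obtain ⟨ψ, rfl⟩ := (Ext.mk₀_bijective _ _).2 ξ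
  rw [Ext.mk₀_comp_mk₀] at hξ
  have hψ := (Ext.mk₀_bijective _ _).1 hξ
  refine ⟨ψ.hom (1 : R), fun r => ?_⟩
  have h1 : ψ.hom (r : R) = φ r := congrArg (fun ψ : ModuleCat.of R L ⟶ H => ψ.hom r) hψ
  rw [← h1, ← map_smul, smul_eq_mul, mul_one]

variable [HasDerivedCategory.{w} (ModuleCat.{u} R)]

theorem subsingleton_ext_of_bijective_comp {N H M : ModuleCat.{u} R} {h : ℕ}
    {ε : ShiftedHom (singleObj H) (singleObj M) (h : ℤ)} (n : ℕ)
    (hε : Function.Injective fun f : HyperExt (singleObj N) H n =>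
      (ShiftedHom.comp f ε rfl : HyperExt (singleObj N) M (h + n)))
    (hs : Subsingleton (Ext N M (h + n))) : Subsingleton (Ext N H n) := by
  have h0 (f : HyperExt (singleObj N) M ((h + n : ℕ) : ℤ)) : f = 0 := by
    obtain ⟨ξ, rfl⟩ := (Ext.homEquiv (X := N) (Y := M) (n := h + n)).surjective f
    rw [hs.elim ξ 0]
    exact Ext.zero_hom ..
  rw [Nat.cast_add] at h0
  refine ⟨fun ξ ξ' => Ext.homEquiv.injective (hε ?_)⟩
  exact (h0 _).trans (h0 _).symm

theorem isCompl_powTorsion_of_isRegular [IsNoetherianRing R] {I J : Ideal R} (hIJ : I ⊔ J ≠ ⊤)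
    {h : ℕ} {rs : List R} (hrs : ∀ r ∈ rs, r ∈ I ⊔ J) (hreg : RingTheory.Sequence.IsRegular R rs)
    (hlen : h + 1 < rs.length) {s : Set R} (hs : Ideal.span s ≤ I ⊓ J) {H : ModuleCat.{u} R}
    (hH : IsPowTorsion (I ⊓ J) H)
    {ε : ShiftedHom (singleObj H) (singleObj (ModuleCat.of R R)) (h : ℤ)}
    (hε : ∀ Y : DerivedCategory (ModuleCat.{u} R), IsTorsionTest s Y →
        ∀ (i j : ℤ) (hij : h + i = j), Function.Bijective fun f : HyperExt Y H i =>
          (ShiftedHom.comp f ε hij : HyperExt Y (ModuleCat.of R R) j)) :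
    IsCompl (powTorsion I H) (powTorsion J H) := by
  have key (a n : ℕ) (hn : n ≤ 1) :
      Subsingleton (Ext (ModuleCat.of R (R ⧸ (I ^ a ⊔ J ^ a : Ideal R))) H n) := by
    have htest : IsTorsionTest s (singleObj (ModuleCat.of R (R ⧸ (I ^ a ⊔ J ^ a : Ideal R)))) := by
      refine isTorsionTest_single fun x hx => ⟨a, fun z => ?_⟩
      obtain ⟨z, rfl⟩ := Submodule.mkQ_surjective _ z
      rw [← map_smul, Submodule.mkQ_apply, Submodule.Quotient.mk_eq_zero, smul_eq_mul]
      exact Ideal.mul_mem_right _ _ (Submodule.mem_sup_left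
        (Ideal.pow_mem_pow (hs.trans inf_le_left (Ideal.subset_span hx)) a))
    refine subsingleton_ext_of_bijective_comp n (hε _ htest n _ rfl).1 ?_
    refine ModuleCat.subsingleton_ext_of_exists_isRegular (I ⊔ J) _ ?_ _ ?_ rs hrs hreg _ (by lia)
    · change Module.support R (R ⧸ (I ^ a ⊔ J ^ a : Ideal R)) ⊆ _
      rw [Module.support_eq_zeroLocus, Ideal.annihilator_quotient]
      intro p hp
      rw [PrimeSpectrum.mem_zeroLocus, SetLike.coe_subset_coe] at hp ⊢
      exact sup_le (p.2.le_of_pow_le (le_sup_left.trans hp))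
        (p.2.le_of_pow_le (le_sup_right.trans hp))
    · change (I ⊔ J) • (⊤ : Ideal R) < ⊤
      rwa [smul_eq_mul, Ideal.mul_top, lt_top_iff_ne_top]
  exact isCompl_powTorsion hH
    (fun a => eq_zero_of_subsingleton_ext_quotient _ H (key a 0 (by lia)))
    fun a => exists_smul_of_subsingleton_ext_quotient _ H (key a 1 le_rfl)

end Decomposition

section Conclusion

variable {R : Type u} [CommRing R]

section

variable [HasDerivedCategory.{w} (ModuleCat.{u} R)]

/-- An endomorphism of `H` with `I`-power torsion image sends the Koszul generator to a multiple
`r • g` such that `I` is nilpotent modulo `l` after multiplication by `r`. -/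
theorem IsKoszulObject.exists_pow_mul_mem {l : List R} {P : DerivedCategory (ModuleCat.{u} R)}
    (hP : IsKoszulObject l P) {g : HyperExt P (ModuleCat.of R R) l.length}
    (hg : ∀ r : R, r • g = 0 → r ∈ Ideal.span {x | x ∈ l}) {I : Ideal R} {H : ModuleCat.{u} R}
    {h : ℕ} {ε : ShiftedHom (singleObj H) (singleObj (ModuleCat.of R R)) (h : ℤ)} {i : ℤ}
    (hi : h + i = l.length) (f : HyperExt P H i) {r : R} (φ : H →ₗ[R] powTorsion I H)
    (hr : (HyperExt.map (ModuleCat.ofHom ((powTorsion I H).subtype ∘ₗ φ)) f).comp ε hi = r • g)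
    {y : R} (hy : y ∈ I) : ∃ m : ℕ, y ^ m * r ∈ Ideal.span {x | x ∈ l} := by
  obtain ⟨m, hm⟩ := hP.exists_pow_smul_eq_zero (ModuleCat.of R (powTorsion I H)) y
    (fun z => (isPowTorsion_powTorsion I H z).imp fun m hm => hm _ (Ideal.pow_mem_pow hy m)) i
    (HyperExt.map (ModuleCat.ofHom φ) f)
  refine ⟨m, hg _ ?_⟩
  rw [mul_smul, ← hr, ← ShiftedHom.smul_comp, ModuleCat.ofHom_comp, HyperExt.map_comp,
    ← HyperExt.map_smul, hm, HyperExt.map_zero, ShiftedHom.zero_comp]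

theorem le_radical_or_le_radical_of_isCompl_powTorsion [IsLocalRing R] {l : List R}
    {P : DerivedCategory (ModuleCat.{u} R)} (hP : IsKoszulObject l P) {I J : Ideal R}
    {H : ModuleCat.{u} R} (hH : IsCompl (powTorsion I H) (powTorsion J H)) {h : ℕ}
    {ε : ShiftedHom (singleObj H) (singleObj (ModuleCat.of R R)) (h : ℤ)}
    (hε : ∀ (i j : ℤ) (hij : h + i = j), Function.Bijective fun f : HyperExt P H i =>
      (ShiftedHom.comp f ε hij : HyperExt P (ModuleCat.of R R) j)) :
    I ≤ (Ideal.span {x | x ∈ l}).radical ∨ J ≤ (Ideal.span {x | x ∈ l}).radical := by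
  obtain ⟨g, hg, hg'⟩ := hP.exists_generator
  have hi : (h : ℤ) + (l.length - h) = l.length := by ring
  obtain ⟨f, hf⟩ := (hε _ _ hi).2 g
  obtain ⟨r, hr⟩ := hg ((HyperExt.map (ModuleCat.ofHom ((powTorsion I H).projection _ hH)) f).comp
    ε hi)
  have hr' : (HyperExt.map (ModuleCat.ofHom ((powTorsion J H).projection _ hH.symm)) f).comp ε hi
      = (1 - r) • g := by
    have hsum : ModuleCat.ofHom ((powTorsion I H).projection _ hH) +
        ModuleCat.ofHom ((powTorsion J H).projection _ hH.symm) = 𝟙 H := by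
      rw [← ModuleCat.ofHom_add, Submodule.projection_add_projection_eq_id]
      rfl
    rw [sub_smul, one_smul, ← hr, eq_sub_iff_add_eq', ← ShiftedHom.add_comp,
      ← HyperExt.map_add_hom, hsum, HyperExt.map_id]
    exact hf
  have aux {r y : R} (hu : IsUnit r) (h : ∃ m : ℕ, y ^ m * r ∈ Ideal.span {x | x ∈ l}) :
      y ∈ (Ideal.span {x | x ∈ l}).radical :=
    h.imp fun m hm => (Ideal.mul_unit_mem_iff_mem _ hu).1 hm
  obtain hu | hu := IsLocalRing.isUnit_or_isUnit_one_sub_self r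
  · exact .inl fun y hy => aux hu (hP.exists_pow_mul_mem hg' hi f _ hr hy)
  · exact .inr fun y hy => aux hu (hP.exists_pow_mul_mem hg' hi f _ hr' hy)

end

theorem length_le_of_isRegular_of_subsingleton_localCohomology [IsNoetherianRing R] [IsLocalRing R]
    {I J : Ideal R} (hIJ : ¬ I.radical ≤ J.radical) (hJI : ¬ J.radical ≤ I.radical) {h : ℕ}
    (hcci : ∀ i : ℕ, i ≠ h →
      Subsingleton ((localCohomology (I ⊓ J) i).obj (ModuleCat.of R R)))
    (htop : I ⊔ J ≠ ⊤) {rs : List R} (hrs : ∀ r ∈ rs, r ∈ I ⊔ J)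
    (hreg : RingTheory.Sequence.IsRegular R rs) : rs.length ≤ h + 1 := by
  by_contra! hlen
  let _ := HasDerivedCategory.standard (ModuleCat.{u} R)
  obtain ⟨s, hs⟩ := (isNoetherianRing_iff_ideal_fg R).1 inferInstance (I ⊓ J)
  obtain ⟨P, hP⟩ := exists_isKoszulObject s.toList
  have hset : {x | x ∈ s.toList} = (s : Set R) := by ext; simp
  obtain ⟨H, hH, ε, hε⟩ := exists_torsion_representation (s := s) h (M := ModuleCat.of R R)
    fun i hi => .of_subsingleton_localCohomology (hs.symm ▸ hcci i hi)
  have hcompl := isCompl_powTorsion_of_isRegular htop hrs hreg hlen hs.le (hs ▸ hH) hε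
  obtain hle | hle := le_radical_or_le_radical_of_isCompl_powTorsion hP hcompl
    (hε P (hset ▸ hP.isTorsionTest))
  · rw [hset, ← Ideal.radical_le_radical_iff, hs] at hle
    exact hIJ (hle.trans (Ideal.radical_mono inf_le_right))
  · rw [hset, ← Ideal.radical_le_radical_iff, hs] at hle
    exact hJI (hle.trans (Ideal.radical_mono inf_le_left))

end Conclusion

end Auxiliary

/-- Main theorem: if `√I ⊄ √J`, `√J ⊄ √I` and `I ∩ J` is a cohomologically complete
intersection (`H^i_{I∩J}(R) = 0` for `i ≠ h`), then `depth(I + J, R) ≤ h + 1`. -/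
theorem depth_sup_le_of_cohomologically_complete_intersection
    {R : Type u} [CommRing R] [IsNoetherianRing R] [IsLocalRing R]
    (I J : Ideal R) (hI : I ≠ ⊤) (hJ : J ≠ ⊤)
    (hIJ : ¬ I.radical ≤ J.radical) (hJI : ¬ J.radical ≤ I.radical)
    (h : ℕ)
    (hcci : ∀ i : ℕ, i ≠ h →
      Subsingleton ((localCohomology (I ⊓ J) i).obj (ModuleCat.of R R))) :
    (I ⊔ J).depthENat R ≤ (h : ℕ∞) + 1 := by
  have htop : I ⊔ J ≠ ⊤ := ne_top_of_le_ne_top (IsLocalRing.maximalIdeal.isMaximal R).ne_top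
    (sup_le (IsLocalRing.le_maximalIdeal hI) (IsLocalRing.le_maximalIdeal hJ))
  rw [Ideal.depthENat, if_neg (by rwa [smul_eq_mul, Ideal.mul_top])]
  refine sSup_le ?_
  rintro _ ⟨rs, hrs, hreg, rfl⟩
  exact_mod_cast length_le_of_isRegular_of_subsingleton_localCohomology hIJ hJI hcci htop hrs hreg
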